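/- Let P(x_1,…,x_n) be a symmetric polynomial of total degree at most n(n+1)/2 in n variables over a field of characteristic zero. Then Σ_{I ⊆ {1,…,n}} P(λ_I) / ( ∏_{i<j} (λ_{i,I} + λ_{j,I}) · ∏_{i=1}^n λ_{i,I} ) = 2^n c(n) / n!, where c(n) is the coefficient of the monomial x_1^{2n−1}⋯x_n^{2n−1} in the polynomial P(x_1,…,x_n) · ∏_{i≠j} (x_i − x_j) · ∏_{i<j} (x_i + x_j). -/

import Mathlib

open Finset

lemma aux_univ {K ι : Type*} [Field K] [Fintype ι] [DecidableEq ι] (v : ι → K)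
    (hv : Function.Injective v) (m : ℕ) (hm : m < Fintype.card ι) :
    ∑ i, v i ^ m / ∏ j ∈ univ.erase i, (v i - v j) =
      if m = Fintype.card ι - 1 then 1 else 0 := by
  have h := Lagrange.coeff_eq_sum (s := (univ : Finset ι)) (v := v) hv.injOn
    (P := (Polynomial.X ^ m : Polynomial K)) (by
      rw [Polynomial.degree_X_pow]; simpa using hm)
  simp only [Polynomial.eval_pow, Polynomial.eval_X, Polynomial.coeff_X_pow, card_univ] at h
  rw [← h]
  simp only [eq_comm]

lemma aux_coeff {K ι : Type*} [Field K] [Fintype ι] [DecidableEq ι] (v : ι → K)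
    (hv : Function.Injective v) (n N : ℕ) (hN : Fintype.card ι = N + 1)
    (Q : MvPolynomial (Fin n) K) (hQ : Q.totalDegree ≤ n * N) :
    ∑ f : Fin n → ι, MvPolynomial.eval (fun i => v (f i)) Q /
        ∏ i, ∏ j ∈ univ.erase (f i), (v (f i) - v j) =
      MvPolynomial.coeff (Finsupp.equivFunOnFinite.symm fun _ => N) Q := by
  simp only [MvPolynomial.eval_eq', Finset.sum_div]
  rw [Finset.sum_comm]
  have key : ∀ d ∈ Q.support, ∑ f : Fin n → ι, MvPolynomial.coeff d Q * (∏ i, v (f i) ^ d i) /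
        ∏ i, ∏ j ∈ univ.erase (f i), (v (f i) - v j) =
      if d = Finsupp.equivFunOnFinite.symm (fun _ => N) then MvPolynomial.coeff d Q else 0 := by
    intro d hd
    have h1 : ∑ f : Fin n → ι, MvPolynomial.coeff d Q * (∏ i, v (f i) ^ d i) /
        ∏ i, ∏ j ∈ univ.erase (f i), (v (f i) - v j) = MvPolynomial.coeff d Q *
        ∏ i, ∑ k : ι, v k ^ d i / ∏ j ∈ univ.erase k, (v k - v j) := by
      rw [Fintype.prod_sum, Finset.mul_sum]
      refine Finset.sum_congr rfl fun f _ => ?_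
      rw [Finset.prod_div_distrib, mul_div_assoc]
    rw [h1]
    split_ifs with h
    · subst h
      rw [Finset.prod_eq_one, mul_one]
      intro i _
      rw [aux_univ v hv _ (by simp [hN])]
      simp [hN]
    · have hs : ∑ i, d i ≤ n * N := by
        refine le_trans ?_ hQ
        have := MvPolynomial.le_totalDegree hd
        rwa [Finsupp.sum_fintype _ _ (fun _ => rfl)] at this
      have : ∃ i, d i < N := by
        by_contra hcon
        push Not at hcon
        apply h
        ext i
        have h2 : ∑ i : Fin n, N = ∑ i, d i :=
          le_antisymm (Finset.sum_le_sum fun i _ => hcon i) (by simpa using hs)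
        have := (Finset.sum_eq_sum_iff_of_le (fun i _ => hcon i)).1 h2 i (mem_univ i)
        simpa using this.symm
      obtain ⟨i, hi⟩ := this
      rw [Finset.prod_eq_zero (mem_univ i), mul_zero]
      rw [aux_univ v hv _ (by omega), if_neg (by omega)]
  rw [Finset.sum_congr rfl key, Finset.sum_ite_eq']
  split_ifs with h
  · rfl
  · exact (MvPolynomial.notMem_support_iff.1 h).symm

lemma aux_offDiag {M : Type*} [CommMonoid M] {n : ℕ} (f : Fin n × Fin n → M) :
    ∏ p ∈ univ.offDiag, f p = ∏ i, ∏ j ∈ univ.erase i, f (i, j) := by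
  rw [Finset.prod_sigma']
  refine Finset.prod_bij' (fun p _ => ⟨p.1, p.2⟩) (fun p _ => (p.1, p.2)) ?_ ?_ ?_ ?_ ?_ <;>
    simp [eq_comm]

lemma aux_perm {M : Type*} [CommMonoid M] {n : ℕ} (σ : Equiv.Perm (Fin n))
    (f : Fin n → Fin n → M) :
    ∏ i, ∏ j ∈ univ.erase i, f (σ i) (σ j) = ∏ i, ∏ j ∈ univ.erase i, f i j := by
  rw [← Equiv.prod_comp σ (fun i => ∏ j ∈ univ.erase i, f i j)]
  refine Finset.prod_congr rfl fun i _ => ?_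
  refine Finset.prod_bij' (fun j _ => σ j) (fun j _ => σ.symm j) ?_ ?_ ?_ ?_ ?_ <;>
    simp [Equiv.symm_apply_eq]

lemma aux_symA {K : Type*} [Field K] {n : ℕ} (s : Fin n → K) (hs : Function.Injective s)
    (σ : Equiv.Perm (Fin n)) :
    ∏ i, ∏ j ∈ Ioi i, (s (σ i) + s (σ j)) = ∏ i, ∏ j ∈ Ioi i, (s i + s j) := by
  have h1 := σ.prod_Ioi_comp_eq_sign_mul_prod (f := fun i j => s i - s j) (fun i j => by ring)
  have h2 := σ.prod_Ioi_comp_eq_sign_mul_prod (f := fun i j => (s i - s j) * (s i + s j))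
    (fun i j => by ring)
  simp only [Finset.prod_mul_distrib] at h2
  rw [h1, mul_assoc] at h2
  have h3 : ((σ.sign : ℤ) : K) ≠ 0 := by
    rcases Int.units_eq_one_or σ.sign with h | h <;> simp [h]
  have h4 : ∏ i, ∏ j ∈ Ioi i, (s i - s j) ≠ 0 := by
    refine Finset.prod_ne_zero_iff.2 fun i _ => Finset.prod_ne_zero_iff.2 fun j hj => ?_
    exact sub_ne_zero.2 (hs.ne (mem_Ioi.1 hj).ne)
  exact mul_left_cancel₀ h4 (mul_left_cancel₀ h3 h2)

lemma aux_sqA {K : Type*} [Field K] {n : ℕ} (s : Fin n → K) :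
    ∏ i, ∏ j ∈ univ.erase i, (s i + s j) = (∏ i, ∏ j ∈ Ioi i, (s i + s j)) ^ 2 := by
  have := Finset.prod_prod_Ioi_mul_eq_prod_prod_off_diag (fun i j : Fin n => s i + s j)
  simp only [compl_singleton] at this
  simp only [sq, ← Finset.prod_mul_distrib]
  rw [Finset.prod_congr rfl fun i _ => Finset.prod_congr rfl fun j _ => add_comm (s i) (s j),
    ← this]
  simp only [add_comm]

/-- signed value -/
def sval {K : Type*} [Field K] {n : ℕ} (lam : Fin n → K) (p : Fin n × Bool) : K :=
  if p.2 then lam p.1 else - lam p.1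

lemma aux_denom {K : Type*} [Field K] {n : ℕ} (lam : Fin n → K) (p : Fin n × Bool) :
    ∏ q ∈ univ.erase p, (sval lam p - sval lam q) =
      2 * sval lam p * ∏ j ∈ univ.erase p.1, (lam p.1 ^ 2 - lam j ^ 2) := by
  obtain ⟨k, b⟩ := p
  have : (univ.erase (k, b) : Finset (Fin n × Bool)) =
      insert (k, !b) ((univ.erase k) ×ˢ univ) := by
    ext ⟨x, y⟩
    simp only [mem_erase, mem_univ, mem_insert, mem_product, Prod.mk.injEq, and_true]
    cases b <;> cases y <;> simp <;> tauto
  rw [this, Finset.prod_insert (by simp), Finset.prod_product]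
  congr 1
  · cases b <;> simp [sval] <;> ring
  · refine Finset.prod_congr rfl fun j _ => ?_
    cases b <;> simp [sval] <;> ring

/-- **The identity of Theorem 1.**  Let `P(x_1,…,x_n)` be a symmetric polynomial of total
degree at most `n(n+1)/2` over a field of characteristic zero, and let `λ_1,…,λ_n` be nonzero
elements with pairwise distinct squares.  Writing `λ_{i,I} = λ_i` if `i ∈ I` and `-λ_i`
otherwise, we have
`Σ_{I ⊆ [n]} P(λ_I) / (∏_{i<j}(λ_{i,I}+λ_{j,I}) · ∏_i λ_{i,I}) = 2^n c(n) / n!`,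
where `c(n)` is the coefficient of `x_1^{2n-1}⋯x_n^{2n-1}` in
`P · ∏_{i≠j}(x_i-x_j) · ∏_{i<j}(x_i+x_j)`. -/
theorem sum_over_subsets_eq_two_pow_mul_coeff_div_factorial
    {K : Type*} [Field K] [CharZero K] (n : ℕ) (hn : 1 ≤ n)
    (lam : Fin n → K) (h0 : ∀ i, lam i ≠ 0)
    (hsq : ∀ i j, i ≠ j → lam i ^ 2 ≠ lam j ^ 2)
    (P : MvPolynomial (Fin n) K) (hP : P.IsSymmetric)
    (hdeg : P.totalDegree ≤ n * (n + 1) / 2) :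
    ∑ I : Finset (Fin n),
        MvPolynomial.eval (fun i => if i ∈ I then lam i else -lam i) P /
          ((∏ i : Fin n, ∏ j ∈ Ioi i,
              ((if i ∈ I then lam i else -lam i) + (if j ∈ I then lam j else -lam j))) *
            ∏ i : Fin n, (if i ∈ I then lam i else -lam i))
      = 2 ^ n *
          MvPolynomial.coeff (Finsupp.equivFunOnFinite.symm fun _ => 2 * n - 1)
            (P * (∏ p ∈ Finset.univ.offDiag, (MvPolynomial.X p.1 - MvPolynomial.X p.2)) *
              ∏ i : Fin n, ∏ j ∈ Ioi i, (MvPolynomial.X i + MvPolynomial.X j)) /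
          (Nat.factorial n : K) := by
  classical
  have hinj : Function.Injective (sval lam) := by
    rintro ⟨k, b⟩ ⟨l, c⟩ h
    have hkl : k = l := by
      by_contra hne
      apply hsq k l hne
      have := congrArg (· ^ 2) h
      cases b <;> cases c <;> simpa [sval] using this
    subst hkl
    have := h0 k
    cases b <;> cases c <;> simp_all [sval, self_eq_neg, neg_eq_self]
  have hdegQ : (P * (∏ p ∈ Finset.univ.offDiag, (MvPolynomial.X p.1 - MvPolynomial.X p.2)) *
              ∏ i : Fin n, ∏ j ∈ Ioi i, (MvPolynomial.X i + MvPolynomial.X j)).totalDegree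
      ≤ n * (2 * n - 1) := by
    have hX : ∀ i : Fin n, (MvPolynomial.X i : MvPolynomial (Fin n) K).totalDegree ≤ 1 :=
      fun i => (MvPolynomial.totalDegree_X i).le
    have hD : (∏ p ∈ (Finset.univ : Finset (Fin n)).offDiag,
        (MvPolynomial.X p.1 - MvPolynomial.X p.2 : MvPolynomial (Fin n) K)).totalDegree
        ≤ n * n - n := by
      refine (MvPolynomial.totalDegree_finsetProd _ _).trans ?_
      refine (Finset.sum_le_card_nsmul _ _ 1 fun p _ => ?_).trans ?_
      · exact (MvPolynomial.totalDegree_sub _ _).trans (max_le (hX _) (hX _))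
      · simp [Finset.offDiag_card]
    have hA : (∏ i : Fin n, ∏ j ∈ Ioi i,
        (MvPolynomial.X i + MvPolynomial.X j : MvPolynomial (Fin n) K)).totalDegree
        ≤ n * (n - 1) / 2 := by
      refine (MvPolynomial.totalDegree_finsetProd _ _).trans ?_
      have : ∀ i : Fin n, (∏ j ∈ Ioi i,
        (MvPolynomial.X i + MvPolynomial.X j : MvPolynomial (Fin n) K)).totalDegree
          ≤ n - 1 - i := by
        intro i
        refine (MvPolynomial.totalDegree_finsetProd _ _).trans ?_
        refine (Finset.sum_le_card_nsmul _ _ 1 fun p _ => ?_).trans ?_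
        · exact (MvPolynomial.totalDegree_add _ _).trans (max_le (hX _) (hX _))
        · simp
      refine (Finset.sum_le_sum fun i _ => this i).trans ?_
      rw [Fin.sum_univ_eq_sum_range (fun i => n - 1 - i) n, Finset.sum_range_reflect (fun i => i) n,
        Finset.sum_range_id]
    refine (MvPolynomial.totalDegree_mul _ _).trans ?_
    have h1 := MvPolynomial.totalDegree_mul P (∏ p ∈ (Finset.univ : Finset (Fin n)).offDiag,
        (MvPolynomial.X p.1 - MvPolynomial.X p.2 : MvPolynomial (Fin n) K))
    refine (add_le_add (h1.trans (add_le_add hdeg hD)) hA).trans ?_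
    obtain ⟨m, rfl⟩ : ∃ m, n = m + 1 := ⟨n - 1, by omega⟩
    have e1 : (m + 1) * (m + 1 + 1) / 2 + (m + 1) * (m + 1 - 1) / 2 = (m + 1) * (m + 1) := by
      have ha : 2 ∣ (m + 1) * (m + 1 + 1) := (Nat.even_mul_succ_self (m + 1)).two_dvd
      have hb : 2 ∣ (m + 1) * (m + 1 - 1) := by
        simpa [mul_comm] using (Nat.even_mul_succ_self m).two_dvd
      rw [← Nat.add_div_of_dvd_right ha, ← mul_add]
      apply Nat.div_eq_of_eq_mul_left two_pos
      simp only [Nat.add_sub_cancel]; ring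
    have e2 : (m + 1) * (m + 1) - (m + 1) = (m + 1) * m := by
      rw [← Nat.mul_sub_one]; simp
    have e3 : 2 * (m + 1) - 1 = (m + 1) + m := by omega
    rw [e2, e3, mul_add (m + 1) (m + 1) m]
    omega
  have hcoef := aux_coeff (sval lam) hinj n (2 * n - 1) (by simp; omega) _ hdegQ
  rw [← hcoef]
  set e : Equiv.Perm (Fin n) × Finset (Fin n) → (Fin n → Fin n × Bool) :=
    fun x i => (x.1 i, decide (x.1 i ∈ x.2)) with he
  have heinj : Function.Injective e := by
    rintro ⟨σ, I⟩ ⟨τ, J⟩ h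
    have h1 : σ = τ := Equiv.ext fun i => congrArg Prod.fst (congrFun h i)
    subst h1
    have h2 : I = J := by
      ext k
      have := congrArg Prod.snd (congrFun h (σ.symm k))
      simpa [he] using this
    rw [h2]
  set s : Finset (Fin n) → Fin n → K := fun I i => if i ∈ I then lam i else -lam i with hs
  have hse : ∀ x i, sval lam (e x i) = s x.2 (x.1 i) := by
    intro x i
    simp [he, hs, sval]
  have hss : ∀ I i, s I i ^ 2 = lam i ^ 2 := by
    intro I i
    simp only [hs]; split_ifs <;> ring
  have hs0 : ∀ I i, s I i ≠ 0 := by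
    intro I i h
    have := hss I i
    rw [h] at this
    exact h0 i (by simpa using this.symm)
  have hadd : ∀ I i j, i ≠ j → s I i + s I j ≠ 0 := by
    intro I i j hij h
    apply hsq i j hij
    rw [← hss I, ← hss I, eq_neg_of_add_eq_zero_left h]; ring
  have hsub : ∀ I i j, i ≠ j → s I i - s I j ≠ 0 := by
    intro I i j hij h
    apply hsq i j hij
    rw [← hss I, ← hss I, sub_eq_zero.1 h]
  have hsinj : ∀ I, Function.Injective (s I) := by
    intro I i j h
    by_contra hne
    exact hsub I i j hne (sub_eq_zero.2 h)
  rw [← Fintype.sum_of_injective e heinj (fun x => (MvPolynomial.eval (s x.2) P /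
      ((∏ i : Fin n, ∏ j ∈ Ioi i, (s x.2 i + s x.2 j)) * ∏ i : Fin n, s x.2 i)) / 2 ^ n)]
  · rw [Fintype.sum_prod_type]
    simp only [Finset.sum_const, card_univ, Fintype.card_perm, Fintype.card_fin, nsmul_eq_mul,
      ← Finset.sum_div]
    have : (n.factorial : K) ≠ 0 := by exact_mod_cast n.factorial_ne_zero
    field_simp
    rfl
  · intro f hf
    have hni : ¬ Function.Injective (fun i => (f i).1) := by
      intro hi
      apply hf
      let σ : Equiv.Perm (Fin n) := Equiv.ofBijective _ (Finite.injective_iff_bijective.1 hi)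
      have hσ : ∀ i, σ i = (f i).1 := fun i => rfl
      refine ⟨(σ, univ.filter fun k => (f (σ.symm k)).2 = true), ?_⟩
      funext i
      simp [he]
      rw [hσ]
    simp only [Function.Injective] at hni
    push Not at hni
    obtain ⟨i, j, hij, hne⟩ := hni
    rw [div_eq_zero_iff]
    left
    simp only [map_mul, map_prod, map_sub, map_add, MvPolynomial.eval_X]
    by_cases hb : (f i).2 = (f j).2
    · have : f i = f j := Prod.ext hij hb
      rw [Finset.prod_eq_zero (i := (i, j)) (s := univ.offDiag) (by simpa using hne)
        (by simp [this])]
      simp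
    · have hz : sval lam (f i) + sval lam (f j) = 0 := by
        simp only [sval, hij]
        cases h1 : (f i).2 <;> cases h2 : (f j).2 <;> simp_all
      rcases lt_or_gt_of_ne hne with h | h
      · rw [Finset.prod_eq_zero (i := i) (s := univ) (mem_univ i)
          (Finset.prod_eq_zero (i := j) (mem_Ioi.2 h) hz)]
        simp
      · rw [Finset.prod_eq_zero (i := j) (s := univ) (mem_univ j)
          (Finset.prod_eq_zero (i := i) (mem_Ioi.2 h) (by rw [add_comm]; exact hz))]
        simp
  · rintro ⟨σ, I⟩
    simp only [aux_denom]
    simp only [hse]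
    simp only [map_mul, map_prod, map_sub, map_add, MvPolynomial.eval_X, aux_offDiag]
    have hPσ : MvPolynomial.eval (fun i => s I (σ i)) P = MvPolynomial.eval (s I) P := by
      conv_rhs => rw [← hP σ, MvPolynomial.eval_rename]
      rfl
    rw [hPσ, aux_symA (s I) (hsinj I) σ, aux_perm σ (fun i j => s I i - s I j)]
    have hden : ∏ i, (2 * s I (σ i) * ∏ j ∈ univ.erase (e (σ, I) i).1,
        (lam (e (σ, I) i).1 ^ 2 - lam j ^ 2)) = 2 ^ n * (∏ i, s I i) *
        ((∏ i, ∏ j ∈ univ.erase i, (s I i - s I j)) * (∏ i, ∏ j ∈ Ioi i, (s I i + s I j)) ^ 2) := by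
      have := Equiv.prod_comp σ (fun i => 2 * s I i * ∏ j ∈ univ.erase i, (lam i ^ 2 - lam j ^ 2))
      simp only [he]
      rw [this, ← aux_sqA]
      simp only [Finset.prod_mul_distrib, Finset.prod_const, card_univ, Fintype.card_fin]
      congr 1
      simp only [← Finset.prod_mul_distrib]
      refine Finset.prod_congr rfl fun i _ => Finset.prod_congr rfl fun j _ => ?_
      rw [← hss I, ← hss I]; ring
    rw [hden]
    have n1 : ∏ i, ∏ j ∈ univ.erase i, (s I i - s I j) ≠ 0 :=
      Finset.prod_ne_zero_iff.2 fun i _ => Finset.prod_ne_zero_iff.2 fun j hj =>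
        hsub I i j (Finset.ne_of_mem_erase hj).symm
    have n2 : ∏ i, ∏ j ∈ Ioi i, (s I i + s I j) ≠ 0 :=
      Finset.prod_ne_zero_iff.2 fun i _ => Finset.prod_ne_zero_iff.2 fun j hj =>
        hadd I i j (mem_Ioi.1 hj).ne
    have n3 : ∏ i, s I i ≠ 0 := Finset.prod_ne_zero_iff.2 fun i _ => hs0 I i
    generalize ∏ i, ∏ j ∈ univ.erase i, (s I i - s I j) = D at *
    generalize ∏ i, ∏ j ∈ Ioi i, (s I i + s I j) = A at *
    generalize ∏ i, s I i = B at *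
    field_simp
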